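/- arXiv:math/0111191 — 2 statements merged into one kernel-verified Lean document; each statement's English description precedes it below -/
import Mathlib

section
/- Let p be an odd prime, F_p ⊆ F_s ⊆ F_t ⊆ F_{t²} a tower of finite fields, N ≥ 1, and let f be a quadratic hermitian form of rank 2ρ on F_t^{2N} (1 ≤ ρ ≤ N), with associated bilinear form B(x,y) = f(x+y) − f(x) − f(y) and T the endomorphism of F_t^{2N} with B(x,y) = T(x)·y. Let a ∈ F_s^*, let v ∈ Im T, and choose u ∈ F_t^{2N} with v = T(u). Then S(af, v) = (−1)^ρ · t^{2N−ρ} · ψ(−a^{-1} f(u)), where ψ(x) = exp(2πi·Tr_{F_t/F_p}(x)/p) and S(g, v) = Σ_{x ∈ F_t^{2N}} ψ(g(x) + v·x). -/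
/-- `H` is a sesquilinear hermitian form on `F_{t²}^N` (conjugation is `x ↦ x^t`). -/
def IsSesquiHermitian {K : Type} [Field K] {N : ℕ} (t : ℕ)
    (H : (Fin N → K) → (Fin N → K) → K) : Prop :=
  (∀ x x' y, H (x + x') y = H x y + H x' y) ∧
  (∀ x y y', H x (y + y') = H x y + H x y') ∧
  (∀ (c : K) (x y : Fin N → K), H (c • x) y = c ^ t * H x y) ∧
  (∀ (c : K) (x y : Fin N → K), H x (c • y) = c * H x y) ∧
  (∀ x y, H x y = H y x ^ t)

/-- The `F_t`-isomorphism `ι : F_t^{2N} → F_{t²}^N`,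
`ι(x₁,…,x₂ₙ) = (x₁ + α x₂, …, x₂ₙ₋₁ + α x₂ₙ)`. -/
def iota (N : ℕ) (F K : Type) [Field F] [Field K] [Algebra F K] (α : K)
    (x : Fin (2 * N) → F) : Fin N → K :=
  fun i => algebraMap F K (x ⟨2 * i.1, by have := i.isLt; omega⟩) +
    algebraMap F K (x ⟨2 * i.1 + 1, by have := i.isLt; omega⟩) * α

open Classical in
lemma zeros_count {K F : Type} [Field K] [Fintype K] [Zero F] {N : ℕ} (h : (Fin N → K) → F)
    (h0 : h 0 = 0) (hs : ∀ (c : K) z, h z = 0 → h (c • z) = 0) :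
    ∃ m : ℕ, Nat.card {z // h z = 0} = 1 + (Fintype.card K - 1) * m := by
  let X := {z : Fin N → K // z ≠ 0 ∧ h z = 0}
  letI : MulAction Kˣ X :=
    { smul := fun c z => ⟨(c : K) • z.1, by
        simpa using z.2.1, hs _ _ z.2.2⟩
      one_smul := fun z => Subtype.ext (one_smul K z.1)
      mul_smul := fun c d z => Subtype.ext (mul_smul (c : K) (d : K) z.1) }
  have hfree : ∀ b : X, MulAction.stabilizer Kˣ b = ⊥ := by
    intro b
    rw [eq_bot_iff]
    intro c hc
    have hc' : (c : K) • b.1 = b.1 := congrArg Subtype.val (MulAction.mem_stabilizer_iff.1 hc)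
    obtain ⟨i, hi⟩ := Function.ne_iff.1 b.2.1
    have := congrFun hc' i
    simp only [Pi.smul_apply, smul_eq_mul] at this
    have h1 : (c : K) = 1 := by
      apply mul_right_cancel₀ hi
      rw [this]; simp
    simpa [Subgroup.mem_bot] using Units.ext h1
  have hX : Fintype.card X =
      Fintype.card (Quotient (MulAction.orbitRel Kˣ X)) * (Fintype.card K - 1) := by
    rw [Fintype.card_congr (MulAction.selfEquivOrbitsQuotientProd hfree), Fintype.card_prod,
      Fintype.card_units]
  refine ⟨Fintype.card (Quotient (MulAction.orbitRel Kˣ X)), ?_⟩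
  rw [mul_comm, ← hX]
  let e : {z // h z = 0} ≃ Option X :=
    { toFun := fun z => if hz : z.1 = 0 then none else some ⟨z.1, hz, z.2⟩
      invFun := fun o => o.elim ⟨0, h0⟩ (fun z => ⟨z.1, z.2.2⟩)
      left_inv := by
        intro z
        by_cases hz : z.1 = 0
        · simp [hz]; exact Subtype.ext hz.symm
        · simp [hz]
      right_inv := by
        intro o
        rcases o with _ | z
        · simp
        · simp [z.2.1] }
  rw [Nat.card_eq_fintype_card, Fintype.card_congr e, Fintype.card_option, add_comm]

lemma char_sum_lin {F : Type} [Field F] [Fintype F] [DecidableEq F] {n : ℕ} (χ : AddChar F ℂ)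
    (hχ : χ ≠ 1) (w : Fin n → F) :
    ∑ y : Fin n → F, χ (∑ i, w i * y i) = if w = 0 then (Fintype.card F : ℂ) ^ n else 0 := by
  split_ifs with hw
  · subst hw; simp
  · let L : (Fin n → F) →+ F :=
      { toFun := fun y => ∑ i, w i * y i
        map_zero' := by simp
        map_add' := by intro x y; simp [mul_add, Finset.sum_add_distrib] }
    have : χ.compAddMonoidHom L ≠ 1 := by
      obtain ⟨z, hz⟩ := AddChar.ne_one_iff.1 hχ
      obtain ⟨i, hi⟩ := Function.ne_iff.1 hw
      apply AddChar.ne_one_iff.2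
      refine ⟨Pi.single i (z / w i), ?_⟩
      rw [AddChar.compAddMonoidHom_apply]
      have : L (Pi.single i (z / w i)) = z := by
        change ∑ j, w j * (Pi.single i (z / w i) : Fin n → F) j = z
        rw [Finset.sum_eq_single i]
        · simp at hi ⊢; field_simp
        · intro j _ hj; simp [hj]
        · simp
      rwa [this]
    exact AddChar.sum_eq_zero_of_ne_one this

lemma gauss_sum_value {F : Type} [Field F] [Fintype F] [DecidableEq F] {N ρ M m t : ℕ}
    (χ : AddChar F ℂ) (hχ : χ ≠ 1) (ht : Fintype.card F = t) (ht3 : 3 ≤ t) (hρ : ρ ≤ N)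
    (h2 : (2 : F) ≠ 0)
    (f : (Fin (2 * N) → F) → F) (T : (Fin (2 * N) → F) →ₗ[F] (Fin (2 * N) → F))
    (hfT : ∀ x y, f (x + y) = f x + f y + ∑ i, T x i * y i)
    (hf4 : ∀ x, f (x + x) = 4 * f x)
    (hW : Fintype.card {z // T z = 0} = t ^ (2 * N - 2 * ρ))
    (hM : Fintype.card {x // f x = 0} = M) (hm : M = 1 + (t ^ 2 - 1) * m)
    (hc : ∀ c : F, c ≠ 0 → ∑ x, χ (c * f x) = ∑ x, χ (f x)) :
    ∑ x, χ (f x) = (-1 : ℂ) ^ ρ * (t : ℂ) ^ (2 * N - ρ) := by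
  set G := ∑ x, χ (f x) with hG
  have hsq : G ^ 2 = ((t : ℂ) ^ (2 * N - ρ)) ^ 2 := by
    have e1 : G ^ 2 = ∑ y, ∑ x, χ (f x - f y) := by
      have := hc (-1) (by simp)
      rw [sq]
      nth_rewrite 1 [← this]
      rw [hG, Finset.sum_mul_sum]
      refine Finset.sum_congr rfl fun y _ => Finset.sum_congr rfl fun x _ => ?_
      rw [← AddChar.map_add_eq_mul]; congr 1; ring
    have e2 : ∀ y, ∑ x, χ (f x - f y) = ∑ z, χ (f z) * χ (∑ i, T z i * y i) := by
      intro y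
      rw [← Equiv.sum_comp (Equiv.addRight y)]
      refine Finset.sum_congr rfl fun z _ => ?_
      rw [← AddChar.map_add_eq_mul, Equiv.coe_addRight, hfT]; congr 1; ring
    rw [e1, Finset.sum_congr rfl fun y _ => e2 y, Finset.sum_comm]
    simp_rw [← Finset.mul_sum, char_sum_lin χ hχ, ht]
    have e3 : ∀ z, χ (f z) * (if T z = 0 then (t : ℂ) ^ (2 * N) else 0) =
        if T z = 0 then (t : ℂ) ^ (2 * N) else 0 := by
      intro z
      split_ifs with hz
      · have h1 := hfT z z
        rw [hf4, hz] at h1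
        simp at h1
        have : f z = 0 := by
          have h3 : (2 : F) * f z = 0 := by linear_combination h1
          simpa [h2] using h3
        simp [this]
      · simp
    rw [Finset.sum_congr rfl fun z _ => e3 z, ← Finset.sum_filter, Finset.sum_const,
      ← Fintype.card_subtype, hW, nsmul_eq_mul]
    push_cast
    rw [← pow_add, ← pow_mul]
    congr 1; omega
  have hlin : (t - 1 : ℂ) * G = t * M - (t : ℂ) ^ (2 * N) := by
    have e1 : ∑ c : F, ∑ x, χ (c * f x) = t * M := by
      rw [Finset.sum_comm]
      have e : ∀ b : F, ∑ c : F, χ (c * b) = if b = 0 then (t : ℂ) else 0 := by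
        intro b
        rw [AddChar.sum_mulShift b (AddChar.IsPrimitive.of_ne_one hχ), ht]
        split_ifs <;> simp
      simp_rw [e]
      rw [← Finset.sum_filter, Finset.sum_const, ← Fintype.card_subtype, hM, nsmul_eq_mul, mul_comm]
    rw [← Finset.add_sum_erase _ _ (Finset.mem_univ (0 : F)),
      Finset.sum_congr rfl (fun c hc' => hc c (Finset.ne_of_mem_erase hc')), Finset.sum_const,
      Finset.card_erase_of_mem (Finset.mem_univ _), Finset.card_univ, ht, nsmul_eq_mul,
      Nat.cast_sub (by omega)] at e1
    simp [ht] at e1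
    rw [← e1]; ring
  obtain ⟨ε, hε, hGe⟩ : ∃ ε : ℤ, (ε = 1 ∨ ε = -1) ∧ G = ε * (t : ℂ) ^ (2 * N - ρ) := by
    rcases sq_eq_sq_iff_eq_or_eq_neg.1 hsq with h | h
    · exact ⟨1, Or.inl rfl, by simp [h]⟩
    · exact ⟨-1, Or.inr rfl, by simp [h]⟩
  have hZ : ((t : ℤ) - 1) * (ε * (t : ℤ) ^ (2 * N - ρ)) = t * M - (t : ℤ) ^ (2 * N) := by
    rw [hGe] at hlin
    exact_mod_cast hlin
  have hMz : (M : ℤ) = 1 + ((t : ℤ) ^ 2 - 1) * m := by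
    rw [hm]; push_cast [Nat.cast_sub (show 1 ≤ t ^ 2 by nlinarith)]; ring
  obtain ⟨n, hn⟩ : ((t : ℤ) ^ 2 - 1) ∣ ((t : ℤ) ^ 2) ^ N - 1 := by
    simpa using sub_dvd_pow_sub_pow ((t : ℤ) ^ 2) 1 N
  have hG1 : ε * (t : ℤ) ^ (2 * N - ρ) = 1 + (t + 1) * (t * m - n) := by
    have : (t : ℤ) - 1 ≠ 0 := by omega
    apply mul_left_cancel₀ this
    rw [hZ, hMz, pow_mul]
    linear_combination -hn
  obtain ⟨k, hk⟩ : ((t : ℤ) + 1) ∣ (t : ℤ) ^ (2 * N - ρ) - (-1) ^ ρ := by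
    have := sub_dvd_pow_sub_pow (t : ℤ) (-1) (2 * N - ρ)
    have h' : (-1 : ℤ) ^ (2 * N - ρ) = (-1) ^ ρ := by
      apply neg_one_pow_congr; 
      rw [Nat.even_sub (by omega)]; simp
    rw [h'] at this
    simpa using this
  have hε2 : ε = (-1) ^ ρ := by
    have hd : ((t : ℤ) + 1) ∣ ε * (-1) ^ ρ - 1 := ⟨t * m - n - ε * k, by linear_combination hG1 - ε * hk⟩
    rcases neg_one_pow_eq_or ℤ ρ with h | h <;> rcases hε with h' | h' <;> rw [h, h'] at hd ⊢ <;>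
    first
    | rfl
    | (exfalso; norm_num at hd; have := Int.le_of_dvd (by norm_num) hd; omega)
  rw [hGe, hε2]; push_cast; rfl

/-- For a quadratic hermitian form `f` of rank `2ρ` on `F_t^{2N}`, `a ∈ F_s^*` and
`v = T(u) ∈ Im T`, the exponential sum `S(af, v) = ∑_x ψ(a·f(x) + v·x)` equals
`(−1)^ρ t^{2N−ρ} ψ(−a⁻¹ f(u))`, where `ψ` is the canonical additive character of
`F_t`. -/
theorem stmt_14 (p s t N ρ : ℕ) [Fact p.Prime] (hpodd : p ≠ 2)
    (hN : 1 ≤ N) (hρ1 : 1 ≤ ρ) (hρN : ρ ≤ N)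
    (Fs Ft K : Type) [Field Fs] [Field Ft] [Field K]
    [Fintype Fs] [Fintype Ft] [Fintype K] [DecidableEq Fs] [DecidableEq Ft]
    [Algebra (ZMod p) Fs] [Algebra (ZMod p) Ft] [Algebra Fs Ft] [Algebra Ft K]
    [IsScalarTower (ZMod p) Fs Ft]
    (hcs : Fintype.card Fs = s) (hct : Fintype.card Ft = t)
    (hcK : Fintype.card K = t ^ 2)
    (H : (Fin N → K) → (Fin N → K) → K) (hH : IsSesquiHermitian t H)
    (α : K) (hα : Algebra.adjoin Ft ({α} : Set K) = ⊤)
    (f : (Fin (2 * N) → Ft) → Ft)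
    (hf : ∀ x, algebraMap Ft K (f x) = H (iota N Ft K α x) (iota N Ft K α x))
    (B : (Fin (2 * N) → Ft) → (Fin (2 * N) → Ft) → Ft)
    (hB : ∀ x y, B x y = f (x + y) - f x - f y)
    (W : Submodule Ft (Fin (2 * N) → Ft)) (hW : ∀ x, x ∈ W ↔ ∀ y, B x y = 0)
    (hrk : 2 * N - Module.finrank Ft W = 2 * ρ)
    (T : (Fin (2 * N) → Ft) →ₗ[Ft] (Fin (2 * N) → Ft))
    (hT : ∀ x y, B x y = ∑ i, T x i * y i)
    (ψ : Ft → ℂ)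
    (hψ : ∀ z, ψ z = Complex.exp
      (2 * Real.pi * Complex.I * ((Algebra.trace (ZMod p) Ft z).val : ℂ) / p))
    (a : Fs) (ha : a ≠ 0) (u v : Fin (2 * N) → Ft) (hv : T u = v) :
    ∑ x : Fin (2 * N) → Ft, ψ (algebraMap Fs Ft a * f x + ∑ i, v i * x i) =
      (-1 : ℂ) ^ ρ * (t : ℂ) ^ (2 * N - ρ) *
        ψ (-(algebraMap Fs Ft a)⁻¹ * f u) := by
  obtain ⟨hA1, hA2, hS1, hS2, -⟩ := hH
  subst hcs
  have : CharP Ft p := charP_of_injective_algebraMap (algebraMap (ZMod p) Ft).injective p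
  have hp := (Fact.out : p.Prime)
  have h2 : (2 : Ft) ≠ 0 := Ring.two_ne_zero (by rw [ringChar.eq Ft p]; exact hpodd)
  have ht3 : 3 ≤ t := by
    have h1 : Fintype.card (ZMod p) ≤ Fintype.card Ft :=
      Fintype.card_le_of_injective _ (algebraMap (ZMod p) Ft).injective
    rw [ZMod.card, hct] at h1
    have := hp.two_le
    omega
  have hι_add : ∀ x y, iota N Ft K α (x + y) = iota N Ft K α x + iota N Ft K α y := by
    intro x y; funext i; simp [iota]; ring
  have hι_smul : ∀ (c : Ft) x, iota N Ft K α (c • x) = algebraMap Ft K c • iota N Ft K α x := by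
    intro c x; funext i; simp [iota]; ring
  have hα' : ∀ c : Ft, algebraMap Ft K c ≠ α := by
    intro c hc
    have hsurj : Function.Surjective (algebraMap Ft K) := by
      intro z
      have hz : z ∈ Algebra.adjoin Ft ({α} : Set K) := by rw [hα]; trivial
      have hle : Algebra.adjoin Ft ({α} : Set K) ≤ ⊥ := by
        rw [Algebra.adjoin_le_iff]
        rintro _ rfl
        exact Algebra.mem_bot.2 ⟨c, hc⟩
      exact Algebra.mem_bot.1 (hle hz)
    have := Fintype.card_le_of_surjective _ hsurj
    rw [hcK, hct] at this
    nlinarith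
  have hι_inj : Function.Injective (iota N Ft K α) := by
    intro x y hxy
    have key : ∀ a b c d : Ft, algebraMap Ft K a + algebraMap Ft K b * α =
        algebraMap Ft K c + algebraMap Ft K d * α → a = c ∧ b = d := by
      intro a b c d h
      have hbd : b = d := by
        by_contra hne
        have hne' : algebraMap Ft K d - algebraMap Ft K b ≠ 0 := by
          rw [← map_sub]; simpa [sub_eq_zero] using fun h => hne h.symm
        apply hα' ((a - c) / (d - b))
        rw [map_div₀, map_sub, map_sub, div_eq_iff hne']
        linear_combination h
      subst hbd
      exact ⟨(algebraMap Ft K).injective (by simpa using h), rfl⟩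
    funext j
    have hj := j.isLt
    have hi := congrFun hxy ⟨j.1 / 2, by omega⟩
    have hk := key _ _ _ _ hi
    rcases Nat.even_or_odd' j.1 with ⟨k, h | h⟩
    · have := hk.1
      convert this using 2 <;> (apply Fin.ext; simp; omega)
    · have := hk.2
      convert this using 2 <;> (apply Fin.ext; simp; omega)
  have hbij : Function.Bijective (iota N Ft K α) := by
    rw [Fintype.bijective_iff_injective_and_card]
    refine ⟨hι_inj, ?_⟩
    simp [hcK, hct, pow_mul]
  let e := Equiv.ofBijective _ hbij
  have he : ∀ x, e x = iota N Ft K α x := fun _ => rfl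
  have hfe : ∀ (l : K) z, algebraMap Ft K (f (e.symm (l • z))) =
      l ^ (t + 1) * algebraMap Ft K (f (e.symm z)) := by
    intro l z
    rw [hf, hf, ← he, ← he, Equiv.apply_symm_apply, Equiv.apply_symm_apply, hS1, hS2]
    ring
  have hfsm : ∀ (c : Ft) x, f (c • x) = c ^ 2 * f x := by
    intro c x
    apply (algebraMap Ft K).injective
    have := FiniteField.pow_card c
    rw [hct] at this
    rw [hf, hι_smul, hS1, hS2, ← hf, ← map_pow, this, map_mul, map_pow]
    ring
  have hfT : ∀ x y, f (x + y) = f x + f y + ∑ i, T x i * y i := by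
    intro x y
    rw [← hT, hB]; ring
  have hf4 : ∀ x, f (x + x) = 4 * f x := by
    intro x
    rw [← two_smul Ft x, hfsm]; norm_num
  have hWT : ∀ z, z ∈ W ↔ T z = 0 := by
    intro z
    rw [hW]
    constructor
    · intro h
      funext i
      have := h (Pi.single i 1)
      rw [hT] at this
      simpa [Pi.single_apply] using this
    · intro h y
      rw [hT, h]; simp
  have hWc : Fintype.card {z // T z = 0} = t ^ (2 * N - 2 * ρ) := by
    have h1 := Module.natCard_eq_pow_finrank (K := Ft) (V := W)
    have h3 : Module.finrank Ft W = 2 * N - 2 * ρ := by omega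
    rw [h3, Nat.card_eq_fintype_card (α := Ft), hct] at h1
    rw [← h1, ← Nat.card_eq_fintype_card]
    exact Nat.card_congr (Equiv.subtypeEquivRight fun z => (hWT z).symm)
  have hzero : f 0 = 0 := by
    have := hfsm 0 0
    simpa using this
  have he0 : e.symm 0 = 0 := by
    rw [Equiv.symm_apply_eq, he]; funext i; simp [iota]
  obtain ⟨m, hm⟩ := zeros_count (K := K) (fun z => f (e.symm z)) (by simp [he0, hzero]) (by
    intro c z hz
    apply (algebraMap Ft K).injective
    change f (e.symm z) = 0 at hz
    rw [hfe, hz]; simp)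
  have hM : Fintype.card {x // f x = 0} = 1 + (t ^ 2 - 1) * m := by
    rw [← hcK, ← hm, ← Nat.card_eq_fintype_card]
    exact Nat.card_congr (e.subtypeEquiv fun x => by simp)
  let χ : AddChar Ft ℂ :=
    (ZMod.stdAddChar (N := p)).compAddMonoidHom (Algebra.trace (ZMod p) Ft).toAddMonoidHom
  have hχψ : ∀ z, ψ z = χ z := by
    intro z
    rw [hψ, AddChar.compAddMonoidHom_apply, ZMod.stdAddChar_apply, ZMod.toCircle_apply]
    rfl
  have hχ : χ ≠ 1 := by
    have h1 : (ZMod.stdAddChar (N := p)) ≠ 1 := by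
      have := ZMod.isPrimitive_stdAddChar p (one_ne_zero)
      simpa using this
    obtain ⟨z, hz⟩ := AddChar.ne_one_iff.1 h1
    obtain ⟨y, rfl⟩ := Algebra.trace_surjective (ZMod p) Ft z
    exact AddChar.ne_one_iff.2 ⟨y, hz⟩
  have hscale : ∀ c : Ft, c ≠ 0 → ∑ x, χ (c * f x) = ∑ x, χ (f x) := by
    intro c hc
    obtain ⟨l, hl⟩ := FiniteField.norm_surjective Ft K c
    have hl' : l ^ (t + 1) = algebraMap Ft K c := by
      rw [← hl, FiniteField.algebraMap_norm_eq_pow, Nat.card_eq_fintype_card,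
        Nat.card_eq_fintype_card, hcK, hct]
      congr 1
      symm
      apply Nat.div_eq_of_eq_mul_left (by omega)
      have := Nat.sq_sub_sq t 1
      simpa using this
    have hl0 : l ≠ 0 := by
      rintro rfl
      rw [zero_pow (by omega)] at hl'
      exact hc ((algebraMap Ft K).injective (by simpa using hl'.symm))
    rw [← Equiv.sum_comp e.symm, ← Equiv.sum_comp e.symm (fun x => χ (f x)),
      ← Equiv.sum_comp (MulAction.toPerm (Units.mk0 l hl0)) (fun z => χ (f (e.symm z)))]
    refine Finset.sum_congr rfl fun z _ => ?_
    congr 1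
    apply (algebraMap Ft K).injective
    rw [map_mul, ← hl', ← hfe]
    rfl
  have hG := gauss_sum_value χ hχ hct ht3 hρN h2 f T hfT hf4 hWc hM rfl hscale
  set c := algebraMap Fs Ft a with hcdef
  have hc0 : c ≠ 0 := by simpa [hcdef] using ha
  rw [← hG, ← hscale c hc0, Finset.sum_mul, ← Equiv.sum_comp (Equiv.addLeft (c⁻¹ • u))
    (fun x => χ (c * f x) * _)]
  refine Finset.sum_congr rfl fun x _ => ?_
  rw [hχψ, hχψ, ← AddChar.map_add_eq_mul]
  congr 1
  rw [Equiv.coe_addLeft, hfT, hfsm, map_smul, hv]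
  simp only [Pi.smul_apply, smul_eq_mul, mul_assoc, ← Finset.mul_sum]
  field_simp
  ring
end

section
/- Let p be an odd prime, F_p ⊆ F_s ⊆ F_t ⊆ F_{t²} finite fields, N ≥ 1, v ∈ F_t^{2N}, and f a quadratic hermitian form of rank 2ρ on F_t^{2N} with 1 ≤ ρ ≤ N, with bilinear form B and endomorphism T satisfying B(x,y) = T(x)·y. Then the number M of x ∈ F_t^{2N} satisfying Tr_{F_t/F_s}(f(x) + v·x) = 0 is: M = (1/s)(t^{2N} + (−1)^ρ A(s,v) t^{2N−ρ}) if v ∈ (Ker B)^⊥ = Im T, where A(s,v) = s−1 if Tr_{F_t/F_s}(f(u)) = 0 for u with T(u) = v and A(s,v) = −1 otherwise; and M = t^{2N}/s if v ∉ (Ker B)^⊥. -/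
/-- All fibres have the same size when the value can be translated arbitrarily. -/
theorem aux_fiber {X F : Type} [Fintype X] [Fintype F] [AddGroup F] (g : X → F)
    (hg : ∀ d, ∃ σ : X ≃ X, ∀ x, g (σ x) = g x + d) (c : F) :
    Fintype.card F * Nat.card {x // g x = c} = Fintype.card X := by
  classical
  have h1 : ∀ c', Nat.card {x // g x = c'} = Nat.card {x // g x = c} := by
    intro c'
    obtain ⟨σ, hσ⟩ := hg (-c' + c)
    refine Nat.card_congr (Equiv.subtypeEquiv σ fun x => ?_)
    rw [hσ, ← add_assoc, add_eq_right, add_neg_eq_zero]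
  rw [← Nat.card_eq_fintype_card (α := X), Nat.card_congr (Equiv.sigmaFiberEquiv g).symm,
    Nat.card_sigma, Finset.sum_congr rfl fun c' _ => h1 c']
  simp

theorem aux_weighted {V F R : Type} [Fintype V] [Field F] [Fintype F] [CommRing R]
    (f : V → F) (n0 n1 : ℕ) (h0 : Nat.card {x // f x = 0} = n0)
    (h1 : ∀ a, a ≠ 0 → Nat.card {x // f x = a} = n1) (φ : F → R) :
    ∑ x, φ (f x) = ((n0 : R) - n1) * φ 0 + n1 * ∑ a, φ a := by
  classical
  have h2 : ∑ x, φ (f x) = ∑ a, (Nat.card {x // f x = a} : R) * φ a := by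
    rw [← (Equiv.sigmaFiberEquiv f).sum_comp, Fintype.sum_sigma]
    refine Finset.sum_congr rfl fun a _ => ?_
    have : ∀ y : {x // f x = a}, φ (f ((Equiv.sigmaFiberEquiv f) ⟨a, y⟩)) = φ a := by
      rintro ⟨y, rfl⟩; rfl
    rw [Finset.sum_congr rfl fun y _ => this y]
    simp
  rw [h2, ← Finset.add_sum_erase _ _ (Finset.mem_univ (0 : F)),
    ← Finset.add_sum_erase _ φ (Finset.mem_univ (0 : F)), h0,
    Finset.sum_congr rfl (g := fun a => (n1 : R) * φ a)
      (fun a ha => by rw [h1 a (Finset.ne_of_mem_erase ha)]), ← Finset.mul_sum]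
  ring

theorem aux_inner {F : Type} [Field F] [Fintype F] {m : ℕ} (ψ : AddChar F ℂ) (hψ : ψ ≠ 0)
    (v : Fin m → F) (hv : v ≠ 0) : ∑ y : Fin m → F, ψ (∑ i, v i * y i) = 0 := by
  classical
  let L : (Fin m → F) →+ F :=
    { toFun := fun y => ∑ i, v i * y i
      map_zero' := by simp
      map_add' := fun a b => by simp [mul_add, Finset.sum_add_distrib] }
  have h : ψ.compAddMonoidHom L ≠ 0 := by
    intro h
    obtain ⟨i, hi⟩ := Function.ne_iff.mp hv
    apply hψ
    ext a
    have := DFunLike.congr_fun h (Pi.single i ((v i)⁻¹ * a))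
    have h2 : L (Pi.single i ((v i)⁻¹ * a)) = a := by
      change ∑ j, v j * (Pi.single i ((v i)⁻¹ * a) : Fin m → F) j = a
      simp only [Pi.zero_apply, ne_eq] at hi
      rw [Finset.sum_eq_single i]
      · simp [hi]
      · intro j _ hj; simp [hj]
      · simp
    rw [AddChar.compAddMonoidHom_apply, h2] at this
    simpa using this
  exact AddChar.sum_eq_zero_iff_ne_zero.2 h

theorem aux_square {F : Type} [Field F] [Fintype F] {m : ℕ} (ψ : AddChar F ℂ) (hψ : ψ ≠ 0)
    (f : (Fin m → F) → F) (T : (Fin m → F) →ₗ[F] (Fin m → F))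
    (hT : ∀ x y, f (x + y) = f x + f y + ∑ i, T x i * y i)
    (W : Submodule F (Fin m → F)) (hW : ∀ x, x ∈ W ↔ T x = 0) (hfW : ∀ x ∈ W, f x = 0) :
    (∑ x, ψ (f x)) * (∑ y, ψ (-f y)) =
      (Fintype.card F : ℂ) ^ m * (Fintype.card F : ℂ) ^ (Module.finrank F W) := by
  classical
  have e1 : (∑ x, ψ (f x)) * (∑ y, ψ (-f y)) = ∑ z, ψ (f z) * ∑ y : Fin m → F, ψ (∑ i, T z i * y i) := by
    rw [Finset.sum_mul_sum, Finset.sum_comm]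
    simp_rw [Finset.mul_sum]
    rw [Finset.sum_comm (s := Finset.univ) (t := Finset.univ)
      (f := fun (z y : Fin m → F) => ψ (f z) * ψ (∑ i, T z i * y i))]
    refine Finset.sum_congr rfl fun y _ => ?_
    refine (Fintype.sum_equiv (Equiv.addRight y) _ _ fun z => ?_).symm
    symm
    rw [← AddChar.map_add_eq_mul, ← AddChar.map_add_eq_mul, Equiv.coe_addRight, hT]
    congr 1; ring
  have e2 : ∀ z, ψ (f z) * ∑ y : Fin m → F, ψ (∑ i, T z i * y i) =
      if z ∈ W then (Fintype.card F : ℂ) ^ m else 0 := by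
    intro z
    split_ifs with h
    · simp [(hW z).1 h, hfW z h]
    · rw [aux_inner ψ hψ _ (fun h' => h ((hW z).2 h')), mul_zero]
  rw [e1, Finset.sum_congr rfl fun z _ => e2 z, ← Finset.sum_filter, Finset.sum_const,
    nsmul_eq_mul, mul_comm]
  congr 1
  have : Fintype.card W = Fintype.card F ^ Module.finrank F W := Module.card_eq_pow_finrank
  rw [← Fintype.card_subtype]
  exact_mod_cast this

theorem aux_char {F : Type} [Field F] [Fintype F] : ∃ ψ : AddChar F ℂ, ψ ≠ 0 := by
  obtain ⟨ψ, h⟩ := AddChar.exists_apply_ne_zero.2 (one_ne_zero (α := F))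
  refine ⟨ψ, ?_⟩
  rintro rfl
  simp at h

/-- Fundamental computation of the number of values. -/
theorem aux_diff {F : Type} [Field F] [Fintype F] {m : ℕ}
    (f : (Fin m → F) → F) (T : (Fin m → F) →ₗ[F] (Fin m → F))
    (hT : ∀ x y, f (x + y) = f x + f y + ∑ i, T x i * y i)
    (W : Submodule F (Fin m → F)) (hW : ∀ x, x ∈ W ↔ T x = 0) (hfW : ∀ x ∈ W, f x = 0)
    (n0 n1 : ℕ) (h0 : Nat.card {x // f x = 0} = n0)
    (h1 : ∀ a, a ≠ 0 → Nat.card {x // f x = a} = n1) :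
    ((n0 : ℤ) - n1) ^ 2 = (Fintype.card F : ℤ) ^ (m + Module.finrank F W) := by
  classical
  obtain ⟨ψ, hψ⟩ := aux_char (F := F)
  have hs := AddChar.sum_eq_zero_iff_ne_zero.2 hψ
  have hs' : ∑ a, ψ (-a) = 0 := by rw [← hs]; exact Fintype.sum_equiv (Equiv.neg F) _ _ fun _ => rfl
  have := aux_square ψ hψ f T hT W hW hfW
  rw [aux_weighted f n0 n1 h0 h1 ψ, aux_weighted f n0 n1 h0 h1 (fun a => ψ (-a)), hs, hs'] at this
  simp only [neg_zero, AddChar.map_zero_eq_one, mul_one, mul_zero, add_zero] at this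
  rw [sq, pow_add]
  exact_mod_cast this

theorem aux_free {K : Type} [Field K] [Fintype K] {N : ℕ} (P : (Fin N → K) → Prop)
    (hP : ∀ (c : K) z, c ≠ 0 → P z → P (c • z)) (hP0 : ¬ P 0) :
    (Fintype.card K - 1) ∣ Nat.card {z // P z} := by
  classical
  let S : SubMulAction Kˣ (Fin N → K) :=
    { carrier := {z | P z}
      smul_mem' := fun c z hz => hP c z c.ne_zero hz }
  have hst : ∀ b : S, MulAction.stabilizer Kˣ b = ⊥ := by
    rintro ⟨b, hb⟩
    rw [eq_bot_iff]
    intro c hc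
    rw [MulAction.mem_stabilizer_iff, Subtype.ext_iff] at hc
    have hc' : (c : K) • b = b := hc
    have hb0 : b ≠ 0 := by rintro rfl; exact hP0 hb
    obtain ⟨i, hi⟩ := Function.ne_iff.mp hb0
    have := congrFun hc' i
    rw [Pi.smul_apply, smul_eq_mul] at this
    rw [Subgroup.mem_bot]
    ext
    exact (mul_eq_right₀ hi).1 this
  have e := Nat.card_congr (MulAction.selfEquivOrbitsQuotientProd hst)
  rw [Nat.card_prod] at e
  rw [← Fintype.card_units, ← Nat.card_eq_fintype_card]
  exact Dvd.intro_left _ e.symm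

theorem aux_sign (t a b ρ : ℕ) (n1 S : ℤ) (ht : 3 ≤ t) (hab : b + ρ = 2 * a)
    (hS : S ^ 2 = (t : ℤ) ^ (2 * b)) (hd : ((t : ℤ) + 1) ∣ n1)
    (he : t * n1 + S = (t : ℤ) ^ (2 * a)) : S = (-1) ^ ρ * (t : ℤ) ^ b := by
  have hm : ((t : ℤ) + 1) ∣ S - 1 := by
    have h2 : ((t : ℤ) + 1) ∣ (t : ℤ) ^ (2 * a) - 1 := by
      have : (t : ℤ) ^ 2 - 1 ∣ ((t : ℤ) ^ 2) ^ a - 1 ^ a := sub_dvd_pow_sub_pow _ _ _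
      rw [pow_mul]
      have h0 : ((t : ℤ) + 1) ∣ (t : ℤ) ^ 2 - 1 := ⟨(t : ℤ) - 1, by ring⟩
      exact h0.trans (by simpa using this)
    have : S - 1 = ((t : ℤ) ^ (2 * a) - 1) - t * n1 := by linarith
    rw [this]
    exact dvd_sub h2 (hd.mul_left _)
  have hb : ((t : ℤ) + 1) ∣ (-1) ^ ρ * (t : ℤ) ^ b - 1 := by
    have h3 : ((t : ℤ) - (-1)) ∣ (t : ℤ) ^ b - (-1) ^ b := sub_dvd_pow_sub_pow _ _ _
    have h4 : (-1 : ℤ) ^ ρ * (-1) ^ b = 1 := by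
      rw [← pow_add, add_comm, hab, pow_mul]; simp
    have : (-1) ^ ρ * (t : ℤ) ^ b - 1 = (-1) ^ ρ * ((t : ℤ) ^ b - (-1) ^ b) := by
      rw [mul_sub, h4]
    rw [this]
    exact Dvd.dvd.mul_left (by simpa using h3) _
  have hsq : S ^ 2 = ((-1) ^ ρ * (t : ℤ) ^ b) ^ 2 := by
    have h6 : ((-1 : ℤ) ^ ρ) ^ 2 = 1 := by rw [← pow_mul, mul_comm, pow_mul]; simp
    rw [hS, mul_pow, h6, one_mul, ← pow_mul, mul_comm]
  rcases sq_eq_sq_iff_eq_or_eq_neg.1 hsq with h | h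
  · exact h
  · exfalso
    have := dvd_add hm hb
    rw [h] at this
    have h5 : ((t : ℤ) + 1) ∣ 2 := by
      rw [← dvd_neg]; convert this using 1; ring
    have := Int.le_of_dvd (by norm_num) h5
    omega

theorem aux_iota {N : ℕ} {F K : Type} [Field F] [Field K] [Fintype F] [Fintype K] [Algebra F K]
    (hcK : Fintype.card K = Fintype.card F ^ 2)
    (α : K) (hα : Algebra.adjoin F ({α} : Set K) = ⊤) :
    Function.Bijective (iota N F K α) := by
  classical
  rw [Fintype.bijective_iff_injective_and_card]
  constructor
  swap
  · simp [hcK, pow_mul]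
  have hnot : ∀ c, algebraMap F K c ≠ α := by
    intro c hc
    have hb : Algebra.adjoin F ({α} : Set K) = ⊥ := by
      rw [eq_bot_iff]
      exact Algebra.adjoin_le (by rintro _ rfl; exact Algebra.mem_bot.2 ⟨c, hc⟩)
    rw [hα] at hb
    have hsurj : Function.Surjective (algebraMap F K) := fun x => by
      have : x ∈ (⊤ : Subalgebra F K) := trivial
      rw [hb] at this
      exact Algebra.mem_bot.1 this
    have h1 := Fintype.card_le_of_surjective _ hsurj
    have h2 := Fintype.one_lt_card (α := F)
    rw [hcK] at h1
    nlinarith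
  have key : ∀ a b a' b' : F, algebraMap F K a + algebraMap F K b * α =
      algebraMap F K a' + algebraMap F K b' * α → a = a' ∧ b = b' := by
    intro a b a' b' h
    have hb : b = b' := by
      by_contra hne
      have hne' : algebraMap F K b - algebraMap F K b' ≠ 0 := by
        rw [← map_sub]
        simpa [sub_eq_zero] using hne
      apply hnot ((a' - a) / (b - b'))
      rw [map_div₀, map_sub, map_sub, div_eq_iff hne']
      linear_combination (-1 : K) * h
    subst hb
    exact ⟨(algebraMap F K).injective (by simpa using h), rfl⟩
  intro x y hxy
  ext ⟨j, hj⟩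
  have hk := key _ _ _ _ (congrFun hxy ⟨j / 2, by omega⟩)
  rcases Nat.even_or_odd' j with ⟨k, rfl | rfl⟩
  · have : 2 * k / 2 = k := by omega
    simpa [this] using hk.1
  · have : (2 * k + 1) / 2 = k := by omega
    simpa [this] using hk.2

theorem aux_norm {F K : Type} [Field F] [Field K] [Fintype F] [Fintype K] [Algebra F K]
    (hcK : Fintype.card K = Fintype.card F ^ 2) (c : F) :
    ∃ l : K, l ^ (Fintype.card F + 1) = algebraMap F K c := by
  obtain ⟨l, hl⟩ := FiniteField.norm_surjective F K c
  refine ⟨l, ?_⟩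
  rw [← hl, FiniteField.algebraMap_norm_eq_pow, Nat.card_eq_fintype_card,
    Nat.card_eq_fintype_card, hcK]
  congr 1
  have h2 := Fintype.one_lt_card (α := F)
  obtain ⟨q, hq⟩ : ∃ q, Fintype.card F = q + 2 := ⟨Fintype.card F - 2, by omega⟩
  rw [hq]
  symm
  apply Nat.div_eq_of_eq_mul_left (by omega)
  rw [Nat.sub_eq_iff_eq_add (by nlinarith)]
  have : q + 2 - 1 = q + 1 := by omega
  rw [this]; ring

/-- The number `M` of solutions of `Tr_{F_t/F_s}(f(x) + v·x) = 0` in `F_t^{2N}`, for a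
quadratic hermitian form `f` of rank `2ρ`: if `v ∈ (Ker B)^⊥ = Im T`, say `v = T(u)`,
then `M = (t^{2N} + (−1)^ρ A(s,v) t^{2N−ρ})/s` with `A(s,v) = s−1` if
`Tr_{F_t/F_s}(f(u)) = 0` and `A(s,v) = −1` otherwise; if `v ∉ (Ker B)^⊥` then
`M = t^{2N}/s`. -/
theorem stmt_17 (p s t N ρ : ℕ) [Fact p.Prime] (hpodd : p ≠ 2)
    (hN : 1 ≤ N) (hρ1 : 1 ≤ ρ) (hρN : ρ ≤ N)
    (Fs Ft K : Type) [Field Fs] [Field Ft] [Field K]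
    [Fintype Fs] [Fintype Ft] [Fintype K] [DecidableEq Fs] [DecidableEq Ft]
    [Algebra (ZMod p) Fs] [Algebra (ZMod p) Ft] [Algebra Fs Ft] [Algebra Ft K]
    [IsScalarTower (ZMod p) Fs Ft]
    (hcs : Fintype.card Fs = s) (hct : Fintype.card Ft = t)
    (hcK : Fintype.card K = t ^ 2)
    (H : (Fin N → K) → (Fin N → K) → K) (hH : IsSesquiHermitian t H)
    (α : K) (hα : Algebra.adjoin Ft ({α} : Set K) = ⊤)
    (f : (Fin (2 * N) → Ft) → Ft)
    (hf : ∀ x, algebraMap Ft K (f x) = H (iota N Ft K α x) (iota N Ft K α x))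
    (B : (Fin (2 * N) → Ft) → (Fin (2 * N) → Ft) → Ft)
    (hB : ∀ x y, B x y = f (x + y) - f x - f y)
    (W : Submodule Ft (Fin (2 * N) → Ft)) (hW : ∀ x, x ∈ W ↔ ∀ y, B x y = 0)
    (hrk : 2 * N - Module.finrank Ft W = 2 * ρ)
    (T : (Fin (2 * N) → Ft) →ₗ[Ft] (Fin (2 * N) → Ft))
    (hT : ∀ x y, B x y = ∑ i, T x i * y i)
    (v : Fin (2 * N) → Ft) :
    (∀ u : Fin (2 * N) → Ft, T u = v →
      (Nat.card {x : Fin (2 * N) → Ft //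
          Algebra.trace Fs Ft (f x + ∑ i, v i * x i) = 0} : ℚ) =
        ((t : ℚ) ^ (2 * N) + (-1 : ℚ) ^ ρ *
          (if Algebra.trace Fs Ft (f u) = 0 then (s : ℚ) - 1 else -1) *
          (t : ℚ) ^ (2 * N - ρ)) / s) ∧
    ((¬ ∀ w : Fin (2 * N) → Ft, (∀ y, B w y = 0) → ∑ i, v i * w i = 0) →
      (Nat.card {x : Fin (2 * N) → Ft //
          Algebra.trace Fs Ft (f x + ∑ i, v i * x i) = 0} : ℚ) =
        (t : ℚ) ^ (2 * N) / s) := by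
  classical
  subst hcs hct
  obtain ⟨-, -, hHl, hHr, -⟩ := hH
  have hfadd : ∀ x y, f (x + y) = f x + f y + ∑ i, T x i * y i := by
    intro x y
    rw [← hT, hB]; ring
  have hWT : ∀ x, x ∈ W ↔ T x = 0 := by
    intro x
    rw [hW]
    constructor
    · intro h
      ext i
      have := h (Pi.single i 1)
      rw [hT] at this
      simpa [Pi.single_apply] using this
    · intro h y
      rw [hT, h]; simp
  have hchar : CharP Ft p := charP_of_injective_algebraMap (algebraMap (ZMod p) Ft).injective p
  have h2 : (2 : Ft) ≠ 0 := by
    intro h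
    have : ((2 : ℕ) : Ft) = 0 := by exact_mod_cast h
    rw [CharP.cast_eq_zero_iff Ft p] at this
    exact hpodd ((Nat.prime_dvd_prime_iff_eq Fact.out Nat.prime_two).1 this)
  have ht3 : 3 ≤ Fintype.card Ft := by
    have h1 : p ∣ Fintype.card Ft := (CharP.cast_eq_zero_iff Ft p _).1 (Nat.cast_card_eq_zero Ft)
    have h3 := Nat.le_of_dvd Fintype.card_pos h1
    have h4 := (Fact.out : p.Prime).two_le
    omega
  set e := Equiv.ofBijective _ (aux_iota (N := N) hcK α hα) with he
  have hfe : ∀ x, algebraMap Ft K (f x) = H (e x) (e x) := hf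
  have hsc : ∀ (l : K) x, algebraMap Ft K (f (e.symm (l • e x))) =
      l ^ (Fintype.card Ft + 1) * algebraMap Ft K (f x) := by
    intro l x
    rw [hfe, hfe, Equiv.apply_symm_apply, hHl, hHr, pow_succ]; ring
  have hf0 : f 0 = 0 := by
    have := hfadd 0 0
    simpa using this
  have hfneg : ∀ x, f (-x) = f x := by
    intro x
    apply (algebraMap Ft K).injective
    have hodd : Even (Fintype.card Ft + 1) := by
      have : Odd (Fintype.card Ft) := by
        rcases FiniteField.even_card_iff_char_two (F := Ft) with h
        rw [Nat.odd_iff]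
        have hr : ringChar Ft ≠ 2 := by
          rw [ringChar.eq Ft p]; exact hpodd
        omega
      exact this.add_one
    have h := hsc (-1) x
    rw [hodd.neg_one_pow, one_mul] at h
    rw [← h]
    congr 2
    rw [Equiv.eq_symm_apply]
    ext i
    change iota N Ft K α (-x) i = (-1 : K) * iota N Ft K α x i
    simp only [iota, Pi.neg_apply, map_neg]
    ring
  have hfW : ∀ x ∈ W, f x = 0 := by
    intro x hx
    have := hfadd x (-x)
    rw [(hWT x).1 hx, hfneg] at this
    simp [hf0] at this
    have h5 : (2 : Ft) * f x = 0 := by rw [two_mul]; exact this.symm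
    exact (mul_eq_zero.1 h5).resolve_left h2
  obtain ⟨n0, h0⟩ : ∃ n0, Nat.card {x // f x = 0} = n0 := ⟨_, rfl⟩
  obtain ⟨n1, h1'⟩ : ∃ n1, Nat.card {x // f x = 1} = n1 := ⟨_, rfl⟩
  have h1 : ∀ a, a ≠ 0 → Nat.card {x // f x = a} = n1 := by
    intro a ha
    rw [← h1']
    obtain ⟨l, hl⟩ := aux_norm hcK a
    have hl0 : l ≠ 0 := by
      rintro rfl
      rw [zero_pow (by omega), eq_comm, map_eq_zero] at hl
      exact ha hl
    refine (Nat.card_congr (Equiv.subtypeEquiv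
      ((e.trans (MulAction.toPerm (Units.mk0 l hl0))).trans e.symm) fun x => ?_)).symm
    have h6 : f (e.symm (l • e x)) = a * f x := by
      apply (algebraMap Ft K).injective
      rw [hsc, hl, map_mul]
    change f x = 1 ↔ f (e.symm (l • e x)) = a
    rw [h6, mul_eq_left₀ ha]
  have hw : ∀ φ : Ft → ℤ, ∑ x, φ (f x) = ((n0 : ℤ) - n1) * φ 0 + n1 * ∑ a, φ a :=
    aux_weighted f n0 n1 h0 h1
  have htot : (Fintype.card Ft : ℤ) * n1 + ((n0 : ℤ) - n1) = (Fintype.card Ft : ℤ) ^ (2 * N) := by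
    have := hw fun _ => 1
    simp at this
    linarith
  have hdvd : ((Fintype.card Ft : ℤ) + 1) ∣ n1 := by
    have h7 := aux_free (fun z => f (e.symm z) ≠ 0) (by
      intro c z hc hz h
      apply hz
      have h8 := hsc c (e.symm z)
      rw [Equiv.apply_symm_apply, h, map_zero, eq_comm, mul_eq_zero] at h8
      exact (map_eq_zero _).1 (h8.resolve_left (pow_ne_zero _ hc))) (by
      have : e.symm 0 = 0 := by
        rw [Equiv.symm_apply_eq]
        ext i
        change _ = iota N Ft K α 0 i
        simp [iota]
      simp [this, hf0])
    have h9 : Nat.card {z // f (e.symm z) ≠ 0} = Nat.card {x // f x ≠ 0} :=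
      Nat.card_congr (Equiv.subtypeEquiv e.symm fun _ => Iff.rfl)
    have h10 : (Nat.card {x // f x ≠ 0} : ℤ) = n1 * ((Fintype.card Ft : ℤ) - 1) := by
      have := hw fun a => if a ≠ 0 then 1 else 0
      rw [Finset.sum_boole, Finset.sum_boole, ← Fintype.card_subtype, ← Fintype.card_subtype] at this
      rw [Nat.card_eq_fintype_card]
      rw [this, Fintype.card_subtype_compl, Fintype.card_subtype_eq]
      simp [Nat.cast_sub (Fintype.card_pos (α := Ft))]
    rw [h9, hcK] at h7
    have h11 : (((Fintype.card Ft ^ 2 - 1 : ℕ)) : ℤ) ∣ (Nat.card {x // f x ≠ 0} : ℤ) :=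
      Int.natCast_dvd_natCast.2 h7
    rw [h10, Nat.cast_sub (Nat.one_le_pow _ _ Fintype.card_pos)] at h11
    have h12 : ((Fintype.card Ft : ℤ) - 1) ≠ 0 := by omega
    apply Int.dvd_of_mul_dvd_mul_right h12
    convert h11 using 1
    push_cast; ring
  have hS : (n0 : ℤ) - n1 = (-1) ^ ρ * (Fintype.card Ft : ℤ) ^ (2 * N - ρ) := by
    refine aux_sign _ N _ ρ n1 _ ht3 (by omega) ?_ hdvd htot
    rw [aux_diff f T hfadd W hWT hfW n0 n1 h0 h1]
    congr 1
    omega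
  have hsurj : Function.Surjective (Algebra.trace Fs Ft) := Algebra.trace_surjective Fs Ft
  have hs0 : (Fintype.card Fs : ℚ) ≠ 0 := by exact_mod_cast Fintype.card_ne_zero
  constructor
  · intro u hu
    have hc : Nat.card {x : Fin (2 * N) → Ft //
        Algebra.trace Fs Ft (f x + ∑ i, v i * x i) = 0} =
        Nat.card {x // Algebra.trace Fs Ft (f x) = Algebra.trace Fs Ft (f u)} := by
      refine Nat.card_congr (Equiv.subtypeEquiv (Equiv.addLeft u) fun x => ?_)
      rw [Equiv.coe_addLeft, hfadd, hu, add_assoc, map_add _ (f u), add_eq_left]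
    have htr : Fintype.card Fs *
        Nat.card {a : Ft // Algebra.trace Fs Ft a = Algebra.trace Fs Ft (f u)} =
        Fintype.card Ft := by
      refine aux_fiber _ (fun d => ?_) _
      obtain ⟨b, hb⟩ := hsurj d
      exact ⟨Equiv.addRight b, fun x => by rw [Equiv.coe_addRight, map_add, hb]⟩
    have h13 := hw fun a => if Algebra.trace Fs Ft a = Algebra.trace Fs Ft (f u) then 1 else 0
    rw [Finset.sum_boole, Finset.sum_boole, ← Fintype.card_subtype, ← Fintype.card_subtype,
      ← Nat.card_eq_fintype_card, ← Nat.card_eq_fintype_card, hS, map_zero] at h13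
    rw [hS] at htot
    rw [hc, eq_div_iff hs0]
    have h13' := congrArg (Int.cast : ℤ → ℚ) h13
    have htot' := congrArg (Int.cast : ℤ → ℚ) htot
    have htr' := congrArg (Nat.cast : ℕ → ℚ) htr
    push_cast at h13' htot' htr'
    rw [h13']
    by_cases h : Algebra.trace Fs Ft (f u) = 0
    · rw [if_pos h, if_pos h.symm]
      linear_combination htot' + (n1 : ℚ) * htr'
    · rw [if_neg h, if_neg (Ne.symm h)]
      linear_combination htot' + (n1 : ℚ) * htr'
  · intro hv
    push Not at hv
    obtain ⟨w, hw1, hw2⟩ := hv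
    have hwW : w ∈ W := (hW w).2 hw1
    have h14 := aux_fiber (fun x : Fin (2 * N) → Ft =>
      Algebra.trace Fs Ft (f x + ∑ i, v i * x i)) (fun d => by
        obtain ⟨b, hb⟩ := hsurj d
        refine ⟨Equiv.addLeft ((b / ∑ i, v i * w i) • w), fun x => ?_⟩
        have hm : (b / ∑ i, v i * w i) • w ∈ W := W.smul_mem _ hwW
        have hvw : ∑ i, v i * ((b / ∑ i, v i * w i) • w + x) i = b + ∑ i, v i * x i := by
          simp only [Pi.add_apply, Pi.smul_apply, smul_eq_mul, mul_add, Finset.sum_add_distrib]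
          congr 1
          simp_rw [mul_left_comm (v _)]
          rw [← Finset.mul_sum, div_mul_cancel₀ _ hw2]
        rw [Equiv.coe_addLeft, hvw, hfadd, hfW _ hm, (hWT _).1 hm, ← hb, ← map_add]
        congr 1
        simp
        ring) 0
    rw [eq_div_iff hs0, mul_comm]
    have h15 := congrArg (Nat.cast : ℕ → ℚ) h14
    push_cast at h15
    rw [h15]
    simp
end
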